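/- arXiv:1311.0557 — 2 statements merged into one kernel-verified Lean document; each statement's English description precedes it below -/
import Mathlib

section
/- In the maximal-rank case (a full N×N zero appears at site m): assume β_{m−1} = β_{m−1,0} + O(ε) ∈ A and β_m = β_{m,1}·ε + β_{m,2}·ε² + O(ε³) with det β_{m,1} ≠ 0, and define the dPI iterates β_{m+1}, β_{m+2}, β_{m+3}. Then: (i) β_{m+1} − m·β_{m,1}⁻¹·ε⁻¹ ∈ A (β_{m+1} has a simple pole with residue m·β_{m,1}⁻¹); (ii) β_{m+2} + m·β_{m,1}⁻¹·ε⁻¹ ∈ A (β_{m+2} has a simple pole with residue −m·β_{m,1}⁻¹); (iii) β_{m+3} = −((m+3)/m)·β_{m,1}·ε + O(ε²), i.e., β_{m+3} ∈ A, its constant term vanishes and its ε-coefficient equals −((m+3)/m)·β_{m,1}. -/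
open Matrix

noncomputable section

/-- The field `ℂ((ε))` of formal Laurent series over `ℂ`. -/
abbrev LS : Type := LaurentSeries ℂ

/-- The complex matrix of coefficients of `ε^k` of a matrix of Laurent series. -/
def coeffM {N : ℕ} (M : Matrix (Fin N) (Fin N) LS) (k : ℤ) : Matrix (Fin N) (Fin N) ℂ :=
  Matrix.of fun i j => (M i j).coeff k

/-- `M ∈ A`: every entry of `M` is a power series (no negative coefficients). -/
def memA {N : ℕ} (M : Matrix (Fin N) (Fin N) LS) : Prop :=
  ∀ i j, ∀ k : ℤ, k < 0 → (M i j).coeff k = 0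

/-- A constant complex matrix viewed as a matrix of Laurent series. -/
def constM {N : ℕ} (X : Matrix (Fin N) (Fin N) ℂ) : Matrix (Fin N) (Fin N) LS :=
  X.map (algebraMap ℂ LS)

/-- The matrix `X·ε^k` of Laurent series supported in degree `k`. -/
def singleM {N : ℕ} (k : ℤ) (X : Matrix (Fin N) (Fin N) ℂ) : Matrix (Fin N) (Fin N) LS :=
  X.map fun x => HahnSeries.single k x

def QL {N : ℕ} (k : ℤ) (X : Matrix (Fin N) (Fin N) ℂ) (M : Matrix (Fin N) (Fin N) LS) : Prop :=
  (∀ i j, ∀ l : ℤ, l < k → (M i j).coeff l = 0) ∧ ∀ i j, (M i j).coeff k = X i j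

theorem QL.add {N : ℕ} {k : ℤ} {X Y : Matrix (Fin N) (Fin N) ℂ}
    {M M' : Matrix (Fin N) (Fin N) LS} (h : QL k X M) (h' : QL k Y M') :
    QL k (X + Y) (M + M') := by
  refine ⟨fun i j l hl => ?_, fun i j => ?_⟩
  · simp [h.1 i j l hl, h'.1 i j l hl]
  · simp [h.2 i j, h'.2 i j]

theorem QL.sub {N : ℕ} {k : ℤ} {X Y : Matrix (Fin N) (Fin N) ℂ}
    {M M' : Matrix (Fin N) (Fin N) LS} (h : QL k X M) (h' : QL k Y M') :
    QL k (X - Y) (M - M') := by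
  refine ⟨fun i j l hl => ?_, fun i j => ?_⟩
  · simp [h.1 i j l hl, h'.1 i j l hl]
  · simp [h.2 i j, h'.2 i j]

theorem QL.smul {N : ℕ} {k : ℤ} {X : Matrix (Fin N) (Fin N) ℂ}
    {M : Matrix (Fin N) (Fin N) LS} (h : QL k X M) (c : ℕ) :
    QL k ((c : ℂ) • X) ((c : LS) • M) := by
  have hc : (c : LS) = HahnSeries.C (c : ℂ) := by simp
  rw [hc]
  refine ⟨fun i j l hl => ?_, fun i j => ?_⟩
  · rw [Matrix.smul_apply, smul_eq_mul, HahnSeries.C_mul_eq_smul, HahnSeries.coeff_smul,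
      h.1 i j l hl, smul_zero]
  · rw [Matrix.smul_apply, smul_eq_mul, HahnSeries.C_mul_eq_smul, HahnSeries.coeff_smul,
      h.2 i j, Matrix.smul_apply]

theorem QL.weaken {N : ℕ} {k l : ℤ} {X : Matrix (Fin N) (Fin N) ℂ}
    {M : Matrix (Fin N) (Fin N) LS} (h : QL k X M) (hl : l < k) : QL l 0 M :=
  ⟨fun i j n hn => h.1 i j n (hn.trans hl), fun i j => h.1 i j l hl⟩

theorem coeff_shift (k l : ℤ) (p : PowerSeries ℂ) :
    (HahnSeries.single k (1 : ℂ) * HahnSeries.ofPowerSeries ℤ ℂ p : LS).coeff l =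
      if l - k < 0 then 0 else PowerSeries.coeff (l - k).natAbs p := by
  have h := HahnSeries.coeff_single_mul_add (r := (1 : ℂ)) (x := HahnSeries.ofPowerSeries ℤ ℂ p)
    (a := l - k) (b := k)
  rw [sub_add_cancel] at h
  rw [h, one_mul]
  exact PowerSeries.coeff_coe p (l - k)

theorem QL_iff {N : ℕ} {k : ℤ} {X : Matrix (Fin N) (Fin N) ℂ}
    {M : Matrix (Fin N) (Fin N) LS} : QL k X M ↔
    ∃ S : Matrix (Fin N) (Fin N) (PowerSeries ℂ),
      M = (HahnSeries.single k (1 : ℂ) : LS) • (HahnSeries.ofPowerSeries ℤ ℂ).mapMatrix S ∧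
      (PowerSeries.constantCoeff (R := ℂ)).mapMatrix S = X := by
  constructor
  · intro h
    refine ⟨Matrix.of fun i j => PowerSeries.mk fun n => (M i j).coeff (k + n), ?_, ?_⟩
    · ext i j l
      rw [Matrix.smul_apply, smul_eq_mul]
      simp only [RingHom.mapMatrix_apply, Matrix.map_apply, Matrix.of_apply]
      rw [coeff_shift]
      split_ifs with hl
      · exact h.1 i j l (by omega)
      · rw [PowerSeries.coeff_mk]
        congr 1
        omega
    · ext i j
      simp [← PowerSeries.coeff_zero_eq_constantCoeff_apply, h.2 i j]
  · rintro ⟨S, rfl, rfl⟩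
    refine ⟨fun i j l hl => ?_, fun i j => ?_⟩
    · rw [Matrix.smul_apply, smul_eq_mul, RingHom.mapMatrix_apply, Matrix.map_apply, coeff_shift,
        if_pos (by omega)]
    · rw [Matrix.smul_apply, smul_eq_mul, RingHom.mapMatrix_apply, Matrix.map_apply, coeff_shift,
        if_neg (by omega)]
      simp

theorem smul_mul_aux {K : Type*} [Field K] {N : ℕ} {a b : K} {P Q : Matrix (Fin N) (Fin N) K}
    (h : a * b = 1) (h' : P * Q = 1) : (a • P) * (b • Q) = 1 := by
  rw [Matrix.smul_mul, Matrix.mul_smul, smul_smul, h, h', one_smul]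

theorem QL.inv {N : ℕ} {k : ℤ} {X : Matrix (Fin N) (Fin N) ℂ}
    {M : Matrix (Fin N) (Fin N) LS} (h : QL k X M) (hX : X.det ≠ 0) : QL (-k) X⁻¹ M⁻¹ := by
  obtain ⟨S, rfl, rfl⟩ := QL_iff.1 h
  have hS : IsUnit S.det := by
    rw [PowerSeries.isUnit_iff_constantCoeff, RingHom.map_det]
    exact isUnit_iff_ne_zero.2 hX
  have hSS := Matrix.mul_nonsing_inv S hS
  refine QL_iff.2 ⟨S⁻¹, ?_, ?_⟩
  · apply Matrix.inv_eq_right_inv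
    refine smul_mul_aux (K := LS) ?_ ?_
    · rw [HahnSeries.single_mul_single]
      simp
    · rw [← map_mul, hSS, map_one]
  · symm
    apply Matrix.inv_eq_right_inv
    rw [← map_mul, hSS, map_one]

theorem QL.memA_sub {N : ℕ} {X : Matrix (Fin N) (Fin N) ℂ}
    {M : Matrix (Fin N) (Fin N) LS} (h : QL (-1) X M) : memA (M - singleM (-1) X) := by
  intro i j l hl
  simp only [singleM, Matrix.sub_apply, Matrix.map_apply, HahnSeries.coeff_sub]
  rcases eq_or_ne l (-1) with rfl | hne
  · simp [h.2 i j]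
  · rw [h.1 i j l (by omega), HahnSeries.coeff_single_of_ne hne, sub_zero]

theorem QL_of_memA {N : ℕ} {M : Matrix (Fin N) (Fin N) LS} (h : memA M) : QL (-1) 0 M :=
  ⟨fun i j l hl => h i j l (by omega), fun i j => h i j (-1) (by omega)⟩

theorem memA_constM {N : ℕ} (X : Matrix (Fin N) (Fin N) ℂ) : memA (constM X) := by
  intro i j l hl
  simp only [constM, Matrix.map_apply]
  have : algebraMap ℂ LS (X i j) = HahnSeries.single 0 (X i j) := by
    refine (LaurentSeries.algebraMap_apply ℂ (X i j)).trans ?_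
    rfl
  rw [this, HahnSeries.coeff_single_of_ne (by omega)]

/-- maximal-rank case, behaviour of `β_{m+1}, β_{m+2}, β_{m+3}`.
If `β_{m−1} = β_{m−1,0} + O(ε) ∈ A` and `β_m = β_{m,1}·ε + β_{m,2}·ε² + O(ε³)` with
`det β_{m,1} ≠ 0`, then for the dPI iterates: `β_{m+1} − m·β_{m,1}⁻¹·ε⁻¹ ∈ A`,
`β_{m+2} + m·β_{m,1}⁻¹·ε⁻¹ ∈ A`, and `β_{m+3} = −((m+3)/m)·β_{m,1}·ε + O(ε²)`. -/
theorem maximal_rank_pole_structure (N m : ℕ) (hN : 1 ≤ N) (hm : 1 ≤ m)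
    (α βprev0 βm1c βm2c : Matrix (Fin N) (Fin N) ℂ)
    (βprev βm β1 β2 β3 : Matrix (Fin N) (Fin N) LS)
    (hprevA : memA βprev) (hprev0 : coeffM βprev 0 = βprev0)
    (hmA : memA βm) (hm0 : coeffM βm 0 = 0)
    (hm1 : coeffM βm 1 = βm1c) (hm2 : coeffM βm 2 = βm2c)
    (hdet1 : βm1c.det ≠ 0)
    (h1 : β1 = (m : LS) • βm⁻¹ - βprev - βm - constM α)
    (h2 : β2 = ((m : LS) + 1) • β1⁻¹ - βm - β1 - constM α)
    (h3 : β3 = ((m : LS) + 2) • β2⁻¹ - β1 - β2 - constM α) :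
    memA (β1 - singleM (-1) ((m : ℂ) • βm1c⁻¹)) ∧
    memA (β2 + singleM (-1) ((m : ℂ) • βm1c⁻¹)) ∧
    (memA β3 ∧ coeffM β3 0 = 0 ∧
      coeffM β3 1 = (-(((m : ℂ) + 3) / (m : ℂ))) • βm1c) := by
  have hm' : (m : ℂ) ≠ 0 := by exact_mod_cast (by omega : m ≠ 0)
  have qm : QL 1 βm1c βm := by
    refine ⟨fun i j l hl => ?_, fun i j => ?_⟩
    · rcases eq_or_ne l 0 with rfl | hne
      · exact congrFun (congrFun hm0 i) j
      · exact hmA i j l (by omega)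
    · exact congrFun (congrFun hm1 i) j
  have hα := QL_of_memA (memA_constM α)
  have q1 : QL (-1) ((m : ℂ) • βm1c⁻¹) β1 := by
    have := ((((qm.inv hdet1).smul m).sub (QL_of_memA hprevA)).sub (QL_of_memA hmA)).sub hα
    rw [← h1] at this
    simpa using this
  have hu : IsUnit βm1c.det := isUnit_iff_ne_zero.2 hdet1
  have hd : ((m : ℂ) • βm1c⁻¹).det ≠ 0 := by
    rw [Matrix.det_smul]
    exact mul_ne_zero (pow_ne_zero _ hm') (Matrix.isUnit_nonsing_inv_det _ hu).ne_zero
  have hinv : ((m : ℂ) • βm1c⁻¹)⁻¹ = (m : ℂ)⁻¹ • βm1c := by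
    apply Matrix.inv_eq_right_inv
    rw [Matrix.smul_mul, Matrix.mul_smul, smul_smul, Matrix.nonsing_inv_mul _ hu,
      mul_inv_cancel₀ hm', one_smul]
  have qi1 : QL 1 ((m : ℂ)⁻¹ • βm1c) β1⁻¹ := by
    have := q1.inv hd
    rwa [hinv, neg_neg] at this
  have c1 : (m : LS) + 1 = ((m + 1 : ℕ) : LS) := by push_cast; rfl
  have c2 : (m : LS) + 2 = ((m + 2 : ℕ) : LS) := by push_cast; rfl
  rw [c1] at h2
  rw [c2] at h3
  have q2 : QL (-1) (-((m : ℂ) • βm1c⁻¹)) β2 := by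
    have := ((((qi1.weaken (l := -1) (by omega)).smul (m + 1)).sub (QL_of_memA hmA)).sub q1).sub hα
    rw [← h2] at this
    simpa using this
  have hd2 : (-((m : ℂ) • βm1c⁻¹)).det ≠ 0 := by
    rw [Matrix.det_neg]
    exact mul_ne_zero (pow_ne_zero _ (by norm_num)) hd
  have hinv2 : (-((m : ℂ) • βm1c⁻¹))⁻¹ = -((m : ℂ)⁻¹ • βm1c) := by
    apply Matrix.inv_eq_right_inv
    rw [neg_mul_neg, ← hinv, Matrix.mul_nonsing_inv _ (isUnit_iff_ne_zero.2 hd)]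
  have qi2 : QL 1 (-((m : ℂ)⁻¹ • βm1c)) β2⁻¹ := by
    have := q2.inv hd2
    rwa [hinv2, neg_neg] at this
  have e3 : β3 = ((m + 2 : ℕ) : LS) • β2⁻¹ - ((m + 1 : ℕ) : LS) • β1⁻¹ + βm := by
    rw [h3]
    generalize β2⁻¹ = Z
    rw [h2]
    abel
  have q3 := ((qi2.smul (m + 2)).sub (qi1.smul (m + 1))).add qm
  rw [← e3] at q3
  refine ⟨q1.memA_sub, ?_, fun i j l hl => q3.1 i j l (by omega), ?_, ?_⟩
  · have h := q2.memA_sub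
    have e : singleM (-1) (-((m : ℂ) • βm1c⁻¹)) = -singleM (-1) ((m : ℂ) • βm1c⁻¹) := by
      ext i j : 2
      simp only [singleM, Matrix.map_apply, Matrix.neg_apply]
      ext l
      rw [HahnSeries.coeff_neg, HahnSeries.coeff_single, HahnSeries.coeff_single]
      split_ifs <;> simp
    rwa [e, sub_neg_eq_add] at h
  · ext i j
    exact q3.1 i j 0 (by omega)
  · ext i j
    refine (q3.2 i j).trans ?_
    simp only [Matrix.add_apply, Matrix.sub_apply, Matrix.smul_apply, Matrix.neg_apply, smul_eq_mul]
    push_cast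
    field_simp
    ring
end
end

section
/- In the maximal-rank case: assume β_{m−1} = β_{m−1,0} + O(ε) ∈ A and β_m = β_{m,1}·ε + β_{m,2}·ε² + O(ε³) with det β_{m,1} ≠ 0, and define the dPI iterates β_{m+1}, β_{m+2}, β_{m+3}, β_{m+4}. Then β_{m+4} ∈ A with constant term β_{m+4}|_{ε=0} = (m/(m+3))·β_{m−1,0} − (2/(m+3))·α; in particular, if det(m·β_{m−1,0} − 2·α) ≠ 0 then det β_{m+4} has ε-adic order 0, so the singularity appearing at site m is confined with confinement time 4. -/
open Matrix

noncomputable section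

abbrev PM (N : ℕ) : Type := Matrix (Fin N) (Fin N) (PowerSeries ℂ)

def phi (N : ℕ) : PM N →+* Matrix (Fin N) (Fin N) LS :=
  (HahnSeries.ofPowerSeries ℤ ℂ).mapMatrix

def cc (N : ℕ) : PM N →+* Matrix (Fin N) (Fin N) ℂ :=
  (PowerSeries.constantCoeff (R := ℂ)).mapMatrix

lemma phi_smul {N : ℕ} (r : PowerSeries ℂ) (M : PM N) :
    phi N (r • M) = (HahnSeries.ofPowerSeries ℤ ℂ r) • phi N M := by
  ext i j : 2
  simp [phi]

lemma cc_smul {N : ℕ} (r : PowerSeries ℂ) (M : PM N) :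
    cc N (r • M) = (PowerSeries.constantCoeff (R := ℂ) r) • cc N M := by
  ext i j : 2
  simp [cc]

lemma memA_phi {N : ℕ} (M : PM N) : memA (phi N M) := by
  intro i j k hk
  simp only [phi, RingHom.mapMatrix_apply, Matrix.map_apply]
  have := PowerSeries.coeff_coe (M i j) k
  rw [if_pos hk] at this
  exact this

lemma coeffM_phi {N : ℕ} (M : PM N) : coeffM (phi N M) 0 = cc N M := by
  ext i j
  have := PowerSeries.coeff_coe (M i j) 0
  simpa [phi, coeffM, cc] using this

lemma exists_phi {N : ℕ} (M : Matrix (Fin N) (Fin N) LS) (h : memA M) :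
    ∃ P : PM N, phi N P = M := by
  refine ⟨Matrix.of fun i j => PowerSeries.mk fun n => (M i j).coeff n, ?_⟩
  ext i j k
  have := PowerSeries.coeff_coe (PowerSeries.mk fun n => (M i j).coeff n) k
  simp only [phi, RingHom.mapMatrix_apply, Matrix.map_apply, Matrix.of_apply]
  refine this.trans ?_
  split_ifs with hk
  · exact (h i j k hk).symm
  · rw [PowerSeries.coeff_mk]
    congr 1
    omega

lemma exists_inv {N : ℕ} (M : PM N) (h : (cc N M).det ≠ 0) :
    ∃ M' : PM N, M * M' = 1 ∧ M' * M = 1 := by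
  have hd : IsUnit M.det := by
    rw [PowerSeries.isUnit_iff_constantCoeff, RingHom.map_det]
    exact isUnit_iff_ne_zero.mpr h
  exact ⟨M⁻¹, Matrix.mul_nonsing_inv _ hd, Matrix.nonsing_inv_mul _ hd⟩

lemma inv_gen {N : ℕ} {S K : Type*} [CommRing S] [Field K] (f : S →+* K) (e : K) (he : e ≠ 0)
    (M M' : Matrix (Fin N) (Fin N) S) (h : M * M' = 1) :
    (e • f.mapMatrix M)⁻¹ = e⁻¹ • f.mapMatrix M' := by
  apply Matrix.inv_eq_right_inv
  rw [smul_mul_smul_comm, ← map_mul, h, map_one, mul_inv_cancel₀ he, one_smul]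

lemma mapM_smul {N : ℕ} {S K : Type*} [CommRing S] [Field K] (f : S →+* K) (r : S)
    (M : Matrix (Fin N) (Fin N) S) : f.mapMatrix (r • M) = f r • f.mapMatrix M := by
  ext i j
  simp

lemma core {N : ℕ} {S K : Type*} [CommRing S] [Field K] (f : S →+* K) (X : S)
    (he : f X ≠ 0) (m : ℕ)
    (p a u u' v v' q w w' t t' r : Matrix (Fin N) (Fin N) S)
    (β1 β2 β3 β4 : Matrix (Fin N) (Fin N) K)
    (huu' : u * u' = 1) (hvv' : v * v' = 1) (hv'v : v' * v = 1)
    (hww' : w * w' = 1) (hw'w : w' * w = 1) (htt' : t * t' = 1) (ht't : t' * t = 1)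
    (hv : v = (m : S) • u' - X • (p + a) - (X * X) • u)
    (hq : q = ((m : S) + 1) • v' - u)
    (hw : w = - v - X • a + (X * X) • q)
    (ht : t = ((m : S) + 2) • w' - q)
    (hr : r = - (u * (p + a)) - q * a - t * a + X • (q * q - u * u))
    (h1 : β1 = (m : K) • (f X • f.mapMatrix u)⁻¹ - f.mapMatrix p - f X • f.mapMatrix u
      - f.mapMatrix a)
    (h2 : β2 = ((m : K) + 1) • β1⁻¹ - f X • f.mapMatrix u - β1 - f.mapMatrix a)
    (h3 : β3 = ((m : K) + 2) • β2⁻¹ - β1 - β2 - f.mapMatrix a)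
    (h4 : β4 = ((m : K) + 3) • β3⁻¹ - β2 - β3 - f.mapMatrix a) :
    β4 = f.mapMatrix (t' * r - X • t) := by
  have huv : u * v = (m : S) • 1 - X • (u * (p + a)) - (X * X) • (u * u) := by
    rw [hv, mul_sub, mul_sub, mul_smul_comm, mul_smul_comm, mul_smul_comm, huu']
  have hqv : q * v = ((m : S) + 1) • 1 - u * v := by
    rw [hq, sub_mul, smul_mul_assoc, hv'v]
  have hqw : q * w = -(q * v) - X • (q * a) + (X * X) • (q * q) := by
    rw [hw, mul_add, mul_sub, mul_neg, mul_smul_comm, mul_smul_comm]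
  have htw : t * w = ((m : S) + 2) • 1 - q * w := by
    rw [ht, sub_mul, smul_mul_assoc, hw'w]
  have hts : t * (((m : S) + 3) • t' - w - X • a) = X • r := by
    rw [mul_sub, mul_sub, mul_smul_comm, mul_smul_comm, htt', htw, hqw, hqv, huv, hr]
    module
  have hs : ((m : S) + 3) • t' - w - X • a = X • (t' * r) := by
    rw [← mul_smul_comm, ← hts, ← mul_assoc, ht't, one_mul]
  have hvK := congrArg f.mapMatrix hv
  have hqK := congrArg f.mapMatrix hq
  have hwK := congrArg f.mapMatrix hw
  have htK := congrArg f.mapMatrix ht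
  have hsK := congrArg f.mapMatrix hs
  simp only [map_sub, map_add, map_neg, mapM_smul, map_mul f, map_natCast, map_ofNat, map_one]
    at hvK hqK hwK htK hsK
  rw [map_sub, mapM_smul]
  have iu := inv_gen f (f X) he u u' huu'
  have iv := inv_gen f (f X)⁻¹ (inv_ne_zero he) v v' hvv'
  have iw := inv_gen f (f X)⁻¹ (inv_ne_zero he) w w' hww'
  have it := inv_gen f (f X) he t t' htt'
  rw [inv_inv] at iv iw
  generalize f X = e at *
  have h1' : β1 = e⁻¹ • f.mapMatrix v := by
    rw [h1, iu, hvK]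
    match_scalars <;> field_simp
  have h2' : β2 = e⁻¹ • f.mapMatrix w := by
    rw [h2, h1', iv, hwK, hqK]
    match_scalars <;> field_simp
  have h3' : β3 = e • f.mapMatrix t := by
    rw [h3, h2', h1', iw, htK, hwK]
    match_scalars <;> field_simp <;> ring
  have hsK' : f.mapMatrix (t' * r) = e⁻¹ • (e • f.mapMatrix (t' * r)) := by
    rw [inv_smul_smul₀ he]
  rw [h4, h3', h2', it, hsK', ← hsK]
  match_scalars <;> field_simp

lemma constM_eq {N : ℕ} (X : Matrix (Fin N) (Fin N) ℂ) :
    constM X = phi N (X.map (PowerSeries.C (R := ℂ))) := by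
  ext i j : 2
  simp only [constM, phi, RingHom.mapMatrix_apply, Matrix.map_apply]
  exact congrArg HahnSeries.coeff (HahnSeries.algebraMap_apply' ℤ (R := ℂ) (S := ℂ) (X i j))

lemma exists_shift {N : ℕ} (M : Matrix (Fin N) (Fin N) LS) (h : memA M)
    (h0 : coeffM M 0 = 0) :
    ∃ U : PM N, M = phi N ((PowerSeries.X : PowerSeries ℂ) • U) ∧ cc N U = coeffM M 1 := by
  obtain ⟨P, rfl⟩ := exists_phi M h
  rw [coeffM_phi] at h0
  have hd : ∀ i j, ∃ u : PowerSeries ℂ, P i j = PowerSeries.X * u := by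
    intro i j
    have : PowerSeries.X ∣ P i j := by
      rw [PowerSeries.X_dvd_iff]
      have := congrFun (congrFun h0 i) j
      simpa [cc] using this
    exact this
  choose U hU using hd
  refine ⟨Matrix.of U, ?_, ?_⟩
  · congr 1
    ext i j : 2
    simp [hU]
  · ext i j
    have := PowerSeries.coeff_coe (P i j) 1
    simp only [coeffM, phi, RingHom.mapMatrix_apply, Matrix.map_apply, Matrix.of_apply]
    refine Eq.trans ?_ this.symm
    rw [hU]
    have h2 := PowerSeries.coeff_succ_X_mul 0 (U i j)
    simp only [zero_add] at h2
    simp [cc, h2]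

/-- maximal-rank case: singularity confinement with confinement
time 4. If `β_{m−1} = β_{m−1,0} + O(ε) ∈ A` and `β_m = β_{m,1}·ε + β_{m,2}·ε² + O(ε³)`
with `det β_{m,1} ≠ 0`, then for the dPI iterates `β_{m+4} ∈ A` with constant term
`(m/(m+3))·β_{m−1,0} − (2/(m+3))·α`; in particular, if `det(m·β_{m−1,0} − 2·α) ≠ 0`
then `det β_{m+4}` has `ε`-adic order `0`. -/
theorem maximal_rank_confinement (N m : ℕ) (hN : 1 ≤ N) (hm : 1 ≤ m)
    (α βprev0 βm1c βm2c : Matrix (Fin N) (Fin N) ℂ)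
    (βprev βm β1 β2 β3 β4 : Matrix (Fin N) (Fin N) LS)
    (hprevA : memA βprev) (hprev0 : coeffM βprev 0 = βprev0)
    (hmA : memA βm) (hm0 : coeffM βm 0 = 0)
    (hm1 : coeffM βm 1 = βm1c) (hm2 : coeffM βm 2 = βm2c)
    (hdet1 : βm1c.det ≠ 0)
    (h1 : β1 = (m : LS) • βm⁻¹ - βprev - βm - constM α)
    (h2 : β2 = ((m : LS) + 1) • β1⁻¹ - βm - β1 - constM α)
    (h3 : β3 = ((m : LS) + 2) • β2⁻¹ - β1 - β2 - constM α)
    (h4 : β4 = ((m : LS) + 3) • β3⁻¹ - β2 - β3 - constM α) :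
    memA β4 ∧
    coeffM β4 0 = ((m : ℂ) / ((m : ℂ) + 3)) • βprev0 - (2 / ((m : ℂ) + 3)) • α ∧
    (((m : ℂ) • βprev0 - (2 : ℂ) • α).det ≠ 0 →
      β4.det ≠ 0 ∧ β4.det.order = 0) := by
  obtain ⟨p, rfl⟩ := exists_phi βprev hprevA
  rw [coeffM_phi] at hprev0
  obtain ⟨u, hb, hu⟩ := exists_shift βm hmA hm0
  rw [hm1] at hu
  obtain ⟨u', huu', hu'u⟩ := exists_inv u (by rwa [hu])
  rw [constM_eq] at h1 h2 h3 h4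
  set a : PM N := α.map (PowerSeries.C (R := ℂ)) with ha
  have hca : cc N a = α := by
    ext i j
    simp [cc, ha]
  set X : PowerSeries ℂ := PowerSeries.X with hX
  set e : LS := HahnSeries.ofPowerSeries ℤ ℂ X with he_def
  have he : e ≠ 0 := by
    simp [he_def, hX]
  have hm0' : (m : ℂ) ≠ 0 := by
    exact_mod_cast (by omega : m ≠ 0)
  have hm3' : (m : ℂ) + 3 ≠ 0 := by
    exact_mod_cast (by omega : m + 3 ≠ 0)
  have hcX : PowerSeries.constantCoeff (R := ℂ) X = 0 := by simp [hX]
  have hcu : cc N u * cc N u' = 1 := by rw [← map_mul, huu', map_one]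
  have hcu' : cc N u' * cc N u = 1 := by rw [← map_mul, hu'u, map_one]
  have hdu' : (cc N u').det ≠ 0 := by
    intro h
    have := congrArg Matrix.det hcu
    rw [Matrix.det_mul, h] at this
    simp at this
  rw [phi_smul] at hb
  -- step 1
  obtain ⟨v, hv⟩ : ∃ v : PM N,
    v = (m : PowerSeries ℂ) • u' - X • (p + a) - (X * X) • u := ⟨_, rfl⟩
  have hcv : cc N v = (m : ℂ) • cc N u' := by
    rw [hv]; simp [cc_smul, hcX]
  obtain ⟨v', hvv', hv'v⟩ := exists_inv v (by
    rw [hcv, Matrix.det_smul]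
    exact mul_ne_zero (pow_ne_zero _ hm0') hdu')
  have hcv' : (m : ℂ) • cc N v' = cc N u := by
    have h : cc N v * cc N v' = 1 := by rw [← map_mul, hvv', map_one]
    rw [hcv] at h
    calc (m : ℂ) • cc N v' = cc N u * (((m : ℂ) • cc N u') * cc N v') := by
          rw [smul_mul_assoc, mul_smul_comm, ← mul_assoc, hcu, one_mul]
      _ = _ := by rw [h, mul_one]
  -- step 2
  obtain ⟨q, hq⟩ : ∃ q : PM N, q = ((m : PowerSeries ℂ) + 1) • v' - u := ⟨_, rfl⟩
  obtain ⟨w, hw⟩ : ∃ w : PM N, w = - v - X • a + (X * X) • q := ⟨_, rfl⟩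
  have hcw : cc N w = -((m : ℂ) • cc N u') := by
    rw [hw]; simp [cc_smul, hcX, hcv]
  obtain ⟨w', hww', hw'w⟩ := exists_inv w (by
    rw [hcw, Matrix.det_neg, Matrix.det_smul]
    exact mul_ne_zero (pow_ne_zero _ (by norm_num)) (mul_ne_zero (pow_ne_zero _ hm0') hdu'))
  have hcw' : (m : ℂ) • cc N w' = - cc N u := by
    have h : cc N w * cc N w' = 1 := by rw [← map_mul, hww', map_one]
    rw [hcw] at h
    calc (m : ℂ) • cc N w' = - (cc N u * (-((m : ℂ) • cc N u') * cc N w')) := by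
          rw [neg_mul, mul_neg, neg_neg, smul_mul_assoc, mul_smul_comm, ← mul_assoc, hcu, one_mul]
      _ = _ := by rw [h, mul_one]
  -- step 3
  obtain ⟨t, ht⟩ : ∃ t : PM N, t = ((m : PowerSeries ℂ) + 2) • w' - q := ⟨_, rfl⟩
  have hcq : (m : ℂ) • cc N q = cc N u := by
    rw [hq, map_sub, cc_smul]
    simp only [map_add, map_natCast, map_one]
    rw [smul_sub, smul_comm, hcv']
    module
  have hct : (m : ℂ) • cc N t = -(((m : ℂ) + 3) • cc N u) := by
    rw [ht, map_sub, cc_smul]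
    simp only [map_add, map_natCast, map_ofNat]
    rw [smul_sub, smul_comm, hcw', hcq]
    module
  have hdt : (cc N t).det ≠ 0 := by
    intro h
    have := congrArg Matrix.det hct
    rw [Matrix.det_neg, Matrix.det_smul, Matrix.det_smul, h, hu, mul_zero] at this
    exact mul_ne_zero (pow_ne_zero _ (by norm_num)) (mul_ne_zero (pow_ne_zero _ hm3') hdet1)
      this.symm
  obtain ⟨t', htt', ht't⟩ := exists_inv t hdt
  -- step 4
  obtain ⟨r, hr⟩ : ∃ r : PM N,
    r = - (u * (p + a)) - q * a - t * a + X • (q * q - u * u) := ⟨_, rfl⟩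
  rw [hb] at h1 h2
  have h4' : β4 = phi N (t' * r - X • t) :=
    core (HahnSeries.ofPowerSeries ℤ ℂ) X he m p a u u' v v' q w w' t t' r β1 β2 β3 β4
      huu' hvv' hv'v hww' hw'w htt' ht't hv hq hw ht hr h1 h2 h3 h4
  have hc4 : cc N (t' * r - X • t) =
      ((m : ℂ) / ((m : ℂ) + 3)) • βprev0 - (2 / ((m : ℂ) + 3)) • α := by
    have hT : cc N t' * cc N u = -(((m : ℂ) / ((m : ℂ) + 3)) • (1 : Matrix (Fin N) (Fin N) ℂ)) := by
      have h : cc N t' * cc N t = 1 := by rw [← map_mul, ht't, map_one]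
      have hu2 : cc N u = -(((m : ℂ) / ((m : ℂ) + 3)) • cc N t) := by
        rw [div_eq_inv_mul, ← smul_smul, hct, smul_neg, neg_neg, smul_smul,
          inv_mul_cancel₀ hm3', one_smul]
      rw [hu2, mul_neg, mul_smul_comm, h]
    have hq2 : cc N q = (m : ℂ)⁻¹ • cc N u := by
      rw [← hcq, smul_smul, inv_mul_cancel₀ hm0', one_smul]
    have ht2 : cc N t = -(((m : ℂ)⁻¹ * ((m : ℂ) + 3)) • cc N u) := by
      rw [← smul_smul, ← smul_neg, ← hct, smul_smul, inv_mul_cancel₀ hm0', one_smul]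
    have hr2 : cc N r = cc N u * ((2 * (m : ℂ)⁻¹) • α - βprev0) := by
      rw [hr]
      simp only [map_sub, map_add, map_neg, map_mul, cc_smul, hcX, hca, hprev0, hq2, ht2,
        mul_sub, mul_add, smul_mul_assoc, mul_smul_comm, neg_mul, zero_smul]
      match_scalars <;> field_simp <;> ring
    rw [map_sub, map_mul, cc_smul, hcX, hr2, ← mul_assoc, hT, zero_smul, sub_zero, neg_mul,
      smul_mul_assoc, one_mul]
    match_scalars <;> field_simp
  refine ⟨h4' ▸ memA_phi _, by rw [h4', coeffM_phi, hc4], fun hd => ?_⟩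
  obtain ⟨B, hB⟩ : ∃ B : PM N, B = t' * r - X • t := ⟨_, rfl⟩
  rw [← hB] at h4' hc4
  have hdB : (cc N B).det ≠ 0 := by
    have : cc N B = ((m : ℂ) + 3)⁻¹ • ((m : ℂ) • βprev0 - (2 : ℂ) • α) := by
      rw [hc4]
      match_scalars <;> field_simp
    rw [this, Matrix.det_smul]
    exact mul_ne_zero (pow_ne_zero _ (inv_ne_zero hm3')) hd
  have hdet : β4.det = HahnSeries.ofPowerSeries ℤ ℂ B.det := by
    rw [h4', phi, ← RingHom.map_det]
  have hB0 : PowerSeries.constantCoeff (R := ℂ) B.det ≠ 0 := by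
    rw [RingHom.map_det]; exact hdB
  have hco0 : β4.det.coeff 0 ≠ 0 := by
    have := PowerSeries.coeff_coe B.det 0
    rw [hdet]
    intro h
    apply hB0
    have h2 := this.symm.trans h
    simpa using h2
  have hne : β4.det ≠ 0 := by
    intro h
    rw [h] at hco0
    simp at hco0
  refine ⟨hne, le_antisymm (HahnSeries.order_le_of_coeff_ne_zero hco0) ?_⟩
  by_contra! hlt
  have h1 := HahnSeries.coeff_order_eq_zero.not.mpr hne
  apply h1
  have := PowerSeries.coeff_coe B.det β4.det.order
  rw [if_pos hlt] at this
  conv_lhs => rw [hdet]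
  rw [← hdet]
  rw [hdet] at this ⊢
  exact this
end
end
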